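/- arXiv:1112.3758 — 2 statements merged into one kernel-verified Lean document; each statement's English description precedes it below -/
import Mathlib

section
/- If L is a regular language over a finite alphabet, then diag(L) = { diag(w) : w ∈ L, |w| = n² for some n ≥ 1 } is regular. -/
/-- `filt a b w` is the word formed by the letters of `w` at positions
`b, a+b, 2a+b, …` that are less than `|w|`. -/
def filt {α : Type*} (a b : ℕ) (w : List α) : List α :=
  (List.range w.length).filterMap (fun i => w[a * i + b]?)

/-- `diag n w` is the diagonal of `w` arranged as an `n × n` array in row-major
order: the letters of `w` at positions `(n+1)·i` for `0 ≤ i ≤ n-1`. -/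
def diag {α : Type*} (n : ℕ) (w : List α) : List α :=
  (List.range n).filterMap (fun i => w[(n + 1) * i]?)

/-- `diagL L = { diag(w) : w ∈ L, |w| = n² for some n ≥ 1 }`. -/
def diagL {α : Type*} (L : Language α) : Language α :=
  { x | ∃ w ∈ L, ∃ n : ℕ, 1 ≤ n ∧ w.length = n ^ 2 ∧ x = diag n w }

theorem List.map_some_filterMap {ι α : Type*} (f : ι → Option α) (l : List ι)
    (h : ∀ i ∈ l, (f i).isSome) : (l.filterMap f).map some = l.map f := by
  induction l with
  | nil => rfl
  | cons i l ih =>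
    obtain ⟨a, ha⟩ := Option.isSome_iff_exists.1 (h i (by simp))
    simp [ha, ih fun j hj => h j (by simp [hj])]

theorem eq_diag_iff {α : Type*} {n : ℕ} {w x : List α} (hw : w.length = n ^ 2) :
    x = diag n w ↔ x.length = n ∧ ∀ i < n, w[(n + 1) * i]? = x[i]? := by
  have hmap : (diag n w).map some = (List.range n).map (fun i => w[(n + 1) * i]?) := by
    refine List.map_some_filterMap _ _ fun i hi => ?_
    rw [List.mem_range] at hi
    have : (n + 1) * i < w.length := by rw [hw]; nlinarith
    simp [this]
  rw [← (Function.Injective.list_map (Option.some_injective α)).eq_iff, hmap]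
  constructor
  · intro h
    have hlen : x.length = n := by simpa using congrArg List.length h
    refine ⟨hlen, fun i hi => ?_⟩
    have := congrArg (fun l => l[i]?) h
    simpa [hi, hlen] using this.symm
  · rintro ⟨hlen, h⟩
    refine List.ext_getElem (by simpa using hlen) fun i hi _ => ?_
    have hi' : i < x.length := by simpa using hi
    simp [h i (hlen ▸ hi'), hi']

namespace DFA

variable {α σ : Type*} (M : DFA α σ)

/-- The states reachable from `S` by reading exactly one letter. -/
def successors (S : Set σ) : Set σ :=
  { t | ∃ s ∈ S, ∃ a, M.step s a = t }

theorem mem_iterate_successors {n : ℕ} {S : Set σ} {t : σ} :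
    t ∈ M.successors^[n] S ↔ ∃ s ∈ S, ∃ u : List α, u.length = n ∧ M.evalFrom s u = t := by
  induction n generalizing S with
  | zero => simp [List.length_eq_zero_iff]
  | succ n ih =>
    rw [Function.iterate_succ_apply, ih]
    constructor
    · rintro ⟨_, ⟨s, hs, a, rfl⟩, u, hu, rfl⟩
      exact ⟨s, hs, a :: u, by simp [hu], rfl⟩
    · rintro ⟨s, hs, _ | ⟨a, u⟩, hu, rfl⟩
      · simp at hu
      · exact ⟨M.step s a, ⟨s, hs, a, rfl⟩, u, by simpa using hu, rfl⟩

/-- Apply the set transformer `T`, then read the letter `a`. -/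
def stepAfter (T : Set σ → Set σ) (S : Set σ) (a : α) : Set σ :=
  (M.step · a) '' T S

theorem mem_foldl_stepAfter {n : ℕ} {S : Set σ} {x : List α} {t : σ} :
    t ∈ x.foldl (M.stepAfter M.successors^[n]) S ↔
      ∃ s ∈ S, ∃ w : List α, w.length = (n + 1) * x.length ∧
        (∀ i < x.length, w[(n + 1) * i + n]? = x[i]?) ∧ M.evalFrom s w = t := by
  induction x generalizing S with
  | nil => simp [List.length_eq_zero_iff]
  | cons a x ih =>
    rw [List.foldl_cons, ih]
    constructor
    · rintro ⟨_, ⟨r, hr, rfl⟩, w, hw, hwx, rfl⟩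
      obtain ⟨s, hs, u, hu, rfl⟩ := M.mem_iterate_successors.1 hr
      refine ⟨s, hs, u ++ a :: w, by simp [hw, hu]; ring, ?_, by simp [evalFrom]⟩
      rintro (_ | i) hi
      · simp [← hu]
      · have h : (n + 1) * (i + 1) + n = u.length + ((n + 1) * i + n + 1) := by rw [hu]; ring
        rw [h, List.getElem?_append_right (by omega)]
        simpa using hwx i (by simpa using hi)
    · rintro ⟨s, hs, w, hw, hwx, rfl⟩
      have hn : n < w.length := by rw [hw, List.length_cons]; nlinarith
      have ha : w[n] = a := by
        have := hwx 0 (by simp)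
        simpa [hn] using this
      refine ⟨_, ⟨_, M.mem_iterate_successors.2
        ⟨s, hs, w.take n, by simp; omega, rfl⟩, rfl⟩, w.drop (n + 1), ?_, ?_, ?_⟩
      · rw [List.length_drop, hw, List.length_cons, Nat.mul_succ]; omega
      · intro i hi
        have := hwx (i + 1) (by simpa using hi)
        rw [List.getElem?_drop]
        rw [List.getElem?_cons_succ] at this
        rw [← this]
        congr 1
        ring
      · have h : w = w.take n ++ a :: w.drop (n + 1) := by
          rw [← ha, List.getElem_cons_drop, List.take_append_drop]
        conv_rhs => rw [h, evalFrom_of_append]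
        rfl

/-- An automaton for the diagonals of the words accepted by `M`. After reading a nonempty word `x`,
it stores the transformer `M.successors^[x.length]` and, for every conceivable effect `T` of the
blocks of letters between diagonal positions, the set of states `M` may have reached. -/
def diagonal : DFA α (Option ((Set σ → Set σ) × ((Set σ → Set σ) → Set σ))) where
  step
    | none, a => some (M.successors, fun _ => {M.step M.start a})
    | some (P, f), a => some (M.successors ∘ P, fun T => M.stepAfter T (f T) a)
  start := none
  accept := { q | ∃ P f, q = some (P, f) ∧ ∃ t ∈ f P, t ∈ M.accept }

theorem diagonal_evalFrom_some (x : List α) (k : ℕ) (f : (Set σ → Set σ) → Set σ) :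
    M.diagonal.evalFrom (some (M.successors^[k], f)) x =
      some (M.successors^[k + x.length], fun T => x.foldl (M.stepAfter T) (f T)) := by
  induction x generalizing k f with
  | nil => rfl
  | cons a x ih =>
    have h : k + (a :: x).length = k + 1 + x.length := by rw [List.length_cons]; omega
    rw [h]
    refine Eq.trans ?_ (ih (k + 1) (fun T => M.stepAfter T (f T) a))
    rw [Function.iterate_succ']
    rfl

theorem nil_notMem_accepts_diagonal : [] ∉ M.diagonal.accepts := by
  rintro ⟨P, f, h, -⟩
  cases h

theorem cons_mem_accepts_diagonal {a : α} {x : List α} :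
    a :: x ∈ M.diagonal.accepts ↔
      ∃ t ∈ x.foldl (M.stepAfter M.successors^[x.length + 1]) {M.step M.start a},
        t ∈ M.accept := by
  have h : M.diagonal.eval (a :: x) = some (M.successors^[1 + x.length],
      fun T => x.foldl (M.stepAfter T) {M.step M.start a}) :=
    M.diagonal_evalFrom_some x 1 (fun _ => {M.step M.start a})
  rw [mem_accepts, h, Nat.add_comm 1]
  constructor
  · rintro ⟨P, f, hPf, ht⟩
    cases hPf
    exact ht
  · exact fun ht => ⟨_, _, rfl, ht⟩

theorem accepts_diagonal : M.diagonal.accepts = diagL M.accepts := by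
  ext x
  cases x with
  | nil =>
    refine iff_of_false M.nil_notMem_accepts_diagonal ?_
    rintro ⟨w, -, n, hn, hw, hx⟩
    have := ((eq_diag_iff hw).1 hx).1
    simp at this
    omega
  | cons a x =>
    rw [cons_mem_accepts_diagonal]
    constructor
    · rintro ⟨t, ht, hacc⟩
      obtain ⟨_, rfl, w, hw, hwx, rfl⟩ := M.mem_foldl_stepAfter.1 ht
      have hlen : (a :: w).length = (x.length + 1) ^ 2 := by rw [List.length_cons, hw]; ring
      refine ⟨a :: w, hacc, x.length + 1, by omega, hlen, (eq_diag_iff hlen).2 ⟨rfl, ?_⟩⟩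
      rintro (_ | i) hi
      · rfl
      · have h : (x.length + 1 + 1) * (i + 1) =
            (x.length + 1 + 1) * i + (x.length + 1) + 1 := by ring
        rw [h, List.getElem?_cons_succ, List.getElem?_cons_succ]
        exact hwx i (by omega)
    · rintro ⟨w, hacc, n, hn, hw, hx⟩
      obtain ⟨rfl, hwx⟩ := (eq_diag_iff hw).1 hx
      rw [List.length_cons] at hw hwx
      obtain _ | ⟨b, w⟩ := w
      · exact absurd hw.symm (by simp)
      obtain rfl : b = a := by simpa using hwx 0 (by omega)
      refine ⟨_, M.mem_foldl_stepAfter.2 ⟨_, rfl, w, ?_, fun i hi => ?_, rfl⟩, hacc⟩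
      · rw [List.length_cons] at hw
        nlinarith
      · have h : (x.length + 1 + 1) * (i + 1) =
            (x.length + 1 + 1) * i + (x.length + 1) + 1 := by ring
        have := hwx (i + 1) (by omega)
        rwa [h, List.getElem?_cons_succ, List.getElem?_cons_succ] at this

end DFA

theorem diagL_regular {α : Type*} [Fintype α] (L : Language α) (hL : L.IsRegular) :
    (diagL L).IsRegular := by
  obtain ⟨σ, _, M, rfl⟩ := hL
  exact ⟨_, Fintype.ofFinite _, M.diagonal, M.accepts_diagonal⟩
end

section
/- There exists a context-free language L such that diag(L) is not context-free. -/
namespace ContextFreeGrammar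

variable {T : Type*} {g : ContextFreeGrammar T}

/-- Sentential forms derive concatenations of what their parts derive. -/
lemma Derives.append {α β α' β' : List (Symbol T g.NT)} (h : g.Derives α α')
    (h' : g.Derives β β') : g.Derives (α ++ β) (α' ++ β') :=
  (h.append_right β).trans (h'.append_left α')

lemma derives_of_mem_rules {r : ContextFreeRule T g.NT} (hr : r ∈ g.rules) :
    g.Derives [.nonterminal r.input] r.output :=
  Produces.single ⟨r, hr, .input_output⟩

/-- `g.Yields S α w`: the sentential form `α` derives the word `w` by a forest of parse trees
all of whose inner nodes are labelled by nonterminals in `S`. -/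
inductive Yields (g : ContextFreeGrammar T) (S : Set g.NT) :
    List (Symbol T g.NT) → List T → Prop
  | nil : Yields g S [] []
  | terminal (t : T) {α : List (Symbol T g.NT)} {w : List T} (h : Yields g S α w) :
      Yields g S (.terminal t :: α) (t :: w)
  | nonterminal {r : ContextFreeRule T g.NT} (hr : r ∈ g.rules) (hS : r.input ∈ S)
      {α : List (Symbol T g.NT)} {u v : List T} (h : Yields g S r.output u)
      (h' : Yields g S α v) : Yields g S (.nonterminal r.input :: α) (u ++ v)

variable {S : Set g.NT} {α β : List (Symbol T g.NT)} {w : List T}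

lemma Yields.derives (h : g.Yields S α w) : g.Derives α (w.map .terminal) := by
  induction h with
  | nil => exact .refl _
  | terminal t _ ih => exact ih.append_left [.terminal t]
  | nonterminal hr _ _ _ ih ih' =>
    rw [List.map_append]
    exact ((derives_of_mem_rules hr).trans ih).append ih'

lemma Yields.append {v : List T} (h : g.Yields S α w) (h' : g.Yields S β v) :
    g.Yields S (α ++ β) (w ++ v) := by
  induction h with
  | nil => exact h'
  | terminal t _ ih => exact .terminal t ih
  | nonterminal hr hS h _ _ ih =>
    rw [List.append_assoc]
    exact .nonterminal hr hS h ih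

lemma Yields.exists_of_append (h : g.Yields S (α ++ β) w) :
    ∃ u v, w = u ++ v ∧ g.Yields S α u ∧ g.Yields S β v := by
  induction α generalizing w with
  | nil => exact ⟨[], w, rfl, .nil, h⟩
  | cons x α ih =>
    cases h with
    | terminal t h =>
      obtain ⟨u, v, rfl, hu, hv⟩ := ih h
      exact ⟨t :: u, v, rfl, .terminal t hu, hv⟩
    | @nonterminal _ hr hS _ p _ h h' =>
      obtain ⟨u, v, rfl, hu, hv⟩ := ih h'
      exact ⟨p ++ u, v, by simp, .nonterminal hr hS h hu, hv⟩

lemma yields_map_terminal (S : Set g.NT) (w : List T) : g.Yields S (w.map .terminal) w := by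
  induction w with
  | nil => exact .nil
  | cons t w ih => exact .terminal t ih

lemma Derives.yields (h : g.Derives α (w.map .terminal)) :
    g.Yields {A | ∃ r ∈ g.rules, r.input = A} α w := by
  induction h using Relation.ReflTransGen.head_induction_on with
  | refl => exact yields_map_terminal _ w
  | head h _ ih =>
    obtain ⟨r, hr, hrw⟩ := h
    obtain ⟨p, q, rfl, rfl⟩ := hrw.exists_parts
    obtain ⟨_, v, rfl, h, hv⟩ := ih.exists_of_append
    obtain ⟨u, x, rfl, hu, hx⟩ := h.exists_of_append
    refine (hu.append ?_).append hv
    have hS : r.input ∈ {A | ∃ r ∈ g.rules, r.input = A} := ⟨r, hr, rfl⟩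
    simpa using Yields.nonterminal hr hS hx .nil

/-- Either the nonterminal `A` can be avoided or some parse subtree is rooted at `A` and has no
other node labelled `A`. -/
lemma Yields.diff_singleton_or (h : g.Yields S α w) (A : g.NT) :
    g.Yields (S \ {A}) α w ∨ ∃ r ∈ g.rules, r.input = A ∧ ∃ u x v, w = u ++ x ++ v ∧
      g.Yields (S \ {A}) r.output x ∧
      g.Derives α (u.map .terminal ++ [.nonterminal A] ++ v.map .terminal) := by
  induction h with
  | nil => exact .inl .nil
  | terminal t _ ih =>
    rcases ih with ih | ⟨r, hr, hA, u, x, v, rfl, hx, hd⟩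
    · exact .inl (.terminal t ih)
    · exact .inr ⟨r, hr, hA, t :: u, x, v, rfl, hx, hd.append_left [.terminal t]⟩
  | @nonterminal r hr hS α p q h h' ih ih' =>
    rcases ih with ih | ⟨r', hr', hA, u, x, v, rfl, hx, hd⟩
    · by_cases hA : r.input = A
      · refine .inr ⟨r, hr, hA, [], p, q, rfl, ih, ?_⟩
        simpa [hA] using h'.derives.append_left [.nonterminal A]
      rcases ih' with ih' | ⟨r', hr', hA', u, x, v, rfl, hx, hd⟩
      · have hSA : r.input ∈ S \ {A} := ⟨hS, hA⟩
        exact .inl (.nonterminal hr hSA ih ih')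
      · refine .inr ⟨r', hr', hA', p ++ u, x, v, by simp, hx, ?_⟩
        simpa using ((derives_of_mem_rules hr).trans h.derives).append hd
    · refine .inr ⟨r', hr', hA, u, x, v ++ q, by simp, hx, ?_⟩
      simpa using ((derives_of_mem_rules hr).trans hd).append h'.derives

/-- `w` factors as `u v x y z` with `v y` nonempty, so that `α` also derives `u v² x y² z`. -/
def Pumps (g : ContextFreeGrammar T) (α : List (Symbol T g.NT)) (w : List T) : Prop :=
  ∃ u v x y z, w = u ++ v ++ x ++ y ++ z ∧ v ++ y ≠ [] ∧
    g.Derives α ((u ++ v ++ v ++ x ++ y ++ y ++ z).map .terminal)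

lemma Pumps.of_derives (h : g.Pumps β w) (hd : g.Derives α β) : g.Pumps α w := by
  obtain ⟨u, v, x, y, z, hw, hne, h⟩ := h
  exact ⟨u, v, x, y, z, hw, hne, hd.trans h⟩

lemma Pumps.append_left (h : g.Pumps β w) {p : List T} (hp : g.Derives α (p.map .terminal)) :
    g.Pumps (α ++ β) (p ++ w) := by
  obtain ⟨u, v, x, y, z, rfl, hne, h⟩ := h
  exact ⟨p ++ u, v, x, y, z, by simp, hne, by simpa using hp.append h⟩

lemma Pumps.append_right (h : g.Pumps α w) {q : List T} (hq : g.Derives β (q.map .terminal)) :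
    g.Pumps (α ++ β) (w ++ q) := by
  obtain ⟨u, v, x, y, z, rfl, hne, h⟩ := h
  exact ⟨u, v, x, y, z ++ q, by simp, hne, by simpa using h.append hq⟩

/-- Words with a parse tree rooted at `A` either pump or have a parse tree in which `A` occurs
at the root only. -/
lemma Yields.pumps_or_exists_rule {A : g.NT} (h : g.Yields S [.nonterminal A] w) (hA : A ∈ S) :
    g.Pumps [.nonterminal A] w ∨
      ∃ r ∈ g.rules, r.input = A ∧ g.Yields (S \ {A}) r.output w := by
  rcases h.diff_singleton_or A with h | ⟨r, hr, rfl, u, x, v, rfl, hx, hd⟩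
  · cases h with
    | nonterminal _ hS => exact absurd rfl hS.2
  by_cases huv : u ++ v = []
  · simp only [List.append_eq_nil_iff] at huv
    obtain ⟨rfl, rfl⟩ := huv
    exact .inr ⟨r, hr, rfl, by simpa using hx⟩
  · refine .inl ⟨[], u, x, v, [], by simp, huv, ?_⟩
    have hx' := (derives_of_mem_rules hr).trans hx.derives
    have hux := (hx'.append_left (u.map .terminal)).append_right (v.map .terminal)
    simpa using hd.trans (((hd.trans hux).append_left (u.map .terminal)).append_right
      (v.map .terminal))

lemma exists_length_le_or_pumps (g : ContextFreeGrammar T) (k : ℕ) :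
    ∃ B : ℕ, ∀ S : Set g.NT, S.Finite → S.ncard ≤ k → ∀ α w, g.Yields S α w →
      w.length ≤ α.length * B ∨ g.Pumps α w := by
  induction k with
  | zero =>
    refine ⟨1, fun S hS hk α w h ↦ ?_⟩
    obtain rfl : S = ∅ := (Set.ncard_eq_zero hS).1 (by omega)
    left
    induction h with
    | nil => simp
    | terminal t _ ih => simpa using ih
    | nonterminal _ hS => exact absurd hS (by simp)
  | succ k ih =>
    obtain ⟨B, hB⟩ := ih
    refine ⟨1 + g.rules.sup (fun r ↦ r.output.length) * B, fun S hS hk α w h ↦ ?_⟩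
    induction h with
    | nil => simp
    | terminal t _ ih =>
      rcases ih with ih | ih
      · left
        simp only [List.length_cons, add_mul]
        omega
      · exact .inr (ih.append_left (α := [.terminal t]) (p := [t]) (.refl _))
    | @nonterminal r hr hrS α u v h h' _ ih =>
      have hd : g.Derives [.nonterminal r.input] (u.map .terminal) :=
        (derives_of_mem_rules hr).trans h.derives
      rcases ih with ih | ih
      · have hu : g.Yields S [.nonterminal r.input] u := by
          simpa using Yields.nonterminal hr hrS h .nil
        rcases hu.pumps_or_exists_rule hrS with hp | ⟨r', hr', he, hy⟩
        · exact .inr (hp.append_right h'.derives)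
        have hcard : (S \ {r.input}).ncard ≤ k := by
          rw [Set.ncard_sdiff_singleton_of_mem hrS]
          omega
        rcases hB _ hS.sdiff hcard _ _ hy with hl | hp
        · left
          have : r'.output.length ≤ g.rules.sup (fun r ↦ r.output.length) :=
            Finset.le_sup (f := fun r : ContextFreeRule T g.NT ↦ r.output.length) hr'
          have := Nat.mul_le_mul_right B this
          rw [List.length_cons, List.length_append, add_mul, one_mul]
          omega
        · exact .inr ((hp.of_derives (he ▸ derives_of_mem_rules hr')).append_right
            (α := [.nonterminal r.input]) h'.derives)
      · exact .inr (ih.append_left hd)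

/-- Soundness of an interpretation of the nonterminals by languages: if all rules are
compatible with it, then so are all derivations. -/
lemma mem_of_derives (J : Symbol T g.NT → Language T) (hJ : ∀ t, [t] ∈ J (.terminal t))
    (hr : ∀ r ∈ g.rules, (r.output.map J).prod ≤ J (.nonterminal r.input))
    (h : g.Derives α (w.map .terminal)) : w ∈ (α.map J).prod := by
  induction h using Relation.ReflTransGen.head_induction_on with
  | refl =>
    induction w with
    | nil => simp
    | cons t w ih =>
      simpa using Language.append_mem_mul (hJ t) ih
  | head h _ ih =>
    obtain ⟨r, hrm, hrw⟩ := h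
    obtain ⟨p, q, rfl, rfl⟩ := hrw.exists_parts
    simp only [List.map_append, List.prod_append, List.map_cons, List.map_nil,
      List.prod_singleton] at ih ⊢
    exact mul_le_mul_left (mul_le_mul_right (hr r hrm) _) _ ih

end ContextFreeGrammar

/-- A weak form of the pumping lemma for context-free languages. -/
theorem Language.IsContextFree.exists_pump {T : Type*} {L : Language T} (hL : L.IsContextFree) :
    ∃ B : ℕ, ∀ w ∈ L, B < w.length → ∃ u v x y z, w = u ++ v ++ x ++ y ++ z ∧ v ++ y ≠ [] ∧
      u ++ v ++ v ++ x ++ y ++ y ++ z ∈ L := by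
  obtain ⟨g, rfl⟩ := hL
  have hfin : {A | ∃ r ∈ g.rules, r.input = A}.Finite := g.rules.finite_toSet.image _
  obtain ⟨B, hB⟩ := g.exists_length_le_or_pumps {A | ∃ r ∈ g.rules, r.input = A}.ncard
  refine ⟨B, fun w hw hlt ↦ ?_⟩
  rcases hB _ hfin le_rfl _ _ (ContextFreeGrammar.Derives.yields hw) with h | h
  · simp at h
    omega
  · exact h

section diag

variable {α : Type*} {n : ℕ} {w : List α}

lemma getElem?_diag (hw : w.length = n ^ 2) (i : ℕ) : (diag n w)[i]? = w[(n + 1) * i]? := by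
  rcases n.eq_zero_or_pos with rfl | hn
  · simp [diag, List.length_eq_zero_iff.1 hw]
  have hlt : ∀ i < n, (n + 1) * i < w.length := by
    intro i hi
    rw [hw]
    obtain ⟨k, rfl⟩ := Nat.exists_eq_add_of_lt hi
    nlinarith
  have : Nonempty α := ⟨w[0]'(by simpa using hlt 0 hn)⟩
  inhabit α
  have h : diag n w = (List.range n).map fun i ↦ w.getD ((n + 1) * i) default := by
    rw [← List.filterMap_eq_map, diag]
    refine List.filterMap_congr fun i hi ↦ ?_
    have := hlt i (List.mem_range.1 hi)
    simp [List.getElem?_eq_getElem this]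
  rw [h]
  by_cases hi : i < n
  · simp [hi, List.getElem?_eq_getElem (hlt i hi)]
  · rw [List.getElem?_eq_none (by simpa using hi), List.getElem?_eq_none]
    rw [hw]
    nlinarith

lemma length_diag (hw : w.length = n ^ 2) : (diag n w).length = n := by
  refine le_antisymm ?_ ?_
  · exact (List.length_filterMap_le _ _).trans (by simp)
  · rcases n.eq_zero_or_pos with rfl | hn
    · simp
    by_contra! h
    have h1 := List.getElem?_eq_none (l := diag n w) (i := n - 1) (by omega)
    rw [getElem?_diag hw, List.getElem?_eq_none_iff, hw] at h1
    obtain ⟨k, rfl⟩ := Nat.exists_eq_add_of_lt hn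
    simp at h1
    nlinarith

lemma diag_sublist (hw : w.length = n ^ 2) : (diag n w).Sublist w := by
  rw [List.sublist_iff_exists_orderEmbedding_getElem?_eq]
  exact ⟨OrderEmbedding.ofStrictMono (fun i ↦ (n + 1) * i)
    fun i j h ↦ Nat.mul_lt_mul_of_pos_left h n.succ_pos, fun i ↦ getElem?_diag hw i⟩

/-- A letter missing from the diagonal has no run of length more than `n`. -/
lemma le_of_replicate_isInfix {a : α} {k : ℕ} (hw : w.length = n ^ 2) (ha : a ∉ diag n w)
    (h : List.replicate k a <:+: w) : k ≤ n := by
  by_contra! hk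
  obtain ⟨s, t, rfl⟩ := h
  refine ha (List.mem_of_getElem? (i := (s.length + n) / (n + 1)) ?_)
  rw [getElem?_diag hw]
  have h1 := Nat.div_add_mod (s.length + n) (n + 1)
  have h2 := Nat.mod_lt (s.length + n) (Nat.add_one_pos n)
  generalize (n + 1) * ((s.length + n) / (n + 1)) = j at *
  rw [List.getElem?_append_left (by simp; omega), List.getElem?_append_right (by omega),
    List.getElem?_replicate, if_pos (by omega)]

lemma getElem?_flatMap_cons_replicate (a : α) (n : ℕ) (d : List α) (i : ℕ) :
    (d.flatMap fun x ↦ x :: List.replicate n a)[(n + 1) * i]? = d[i]? := by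
  induction d generalizing i with
  | nil => simp
  | cons x d ih =>
    cases i with
    | zero => simp
    | succ i =>
      rw [List.flatMap_cons, List.getElem?_append_right (by grind),
        List.getElem?_cons_succ, ← ih]
      congr 1
      simp
      rw [mul_add]
      omega

/-- A word is the diagonal of the array that contains its letters on the diagonal and the
letter `a` elsewhere. -/
lemma diag_flatMap_cons_replicate (a x : α) {d : List α} (hd : d.length + 1 = n) :
    ((d.flatMap fun y ↦ y :: List.replicate n a) ++ [x]).length = n ^ 2 ∧
      diag n ((d.flatMap fun y ↦ y :: List.replicate n a) ++ [x]) = d ++ [x] := by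
  have hl : ((d.flatMap fun y ↦ y :: List.replicate n a) ++ [x]).length = n ^ 2 := by
    subst hd
    simp [List.length_flatMap]
    ring
  refine ⟨hl, List.ext_getElem? fun i ↦ ?_⟩
  by_cases hi : i < n
  · have hlt : (n + 1) * i < n ^ 2 := by
      obtain ⟨k, rfl⟩ := Nat.exists_eq_add_of_lt hi
      nlinarith
    rw [getElem?_diag hl, ← getElem?_flatMap_cons_replicate a n (d ++ [x]), List.flatMap_append,
      ← List.getElem?_append_left (l₂ := List.replicate n a) (hlt.trans_eq hl.symm)]
    simp
  · rw [List.getElem?_eq_none (by rw [length_diag hl]; omega),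
      List.getElem?_eq_none (by simp; omega)]

end diag

/-- The letters of the array words: `0`, `1`, `2`. -/
def blockLetter (s : Fin 3) : Fin 11 := s.castLE (by omega)

/-- The rules of `blockGrammar`. -/
def blockRules : Finset (ContextFreeRule (Fin 11) (Option (Bool × Fin 3))) :=
  {⟨none, [.terminal 0, .nonterminal (some (true, 0)), .terminal 1,
    .nonterminal (some (true, 1)), .terminal 2, .nonterminal (some (true, 2))]⟩} ∪
  (Finset.univ.image (fun s ↦ ⟨some (true, s), [.terminal 3, .terminal 3, .terminal 3,
    .nonterminal (some (true, s)), .nonterminal (some (false, s))]⟩) ∪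
  (Finset.univ.image (fun s ↦ ⟨some (true, s), [.terminal 3, .terminal 3, .terminal 3]⟩) ∪
  (Finset.univ.image (fun s ↦ ⟨some (false, s), [.nonterminal (some (false, s)), .terminal 3]⟩) ∪
  Finset.univ.image (fun s ↦ ⟨some (false, s), [.terminal (blockLetter s)]⟩))))

/-- A grammar for words `0 F₀ 1 F₁ 2 F₂`, where `Fₛ` starts with a run of at least `3 (m + 1)`
letters `3`, and the letters of `Fₛ` other than `3` are `m` letters `s`. The nonterminals are the
initial one, `(true, s)` for `Fₛ`, and `(false, s)` for a letter `s` followed by letters `3`. -/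
def blockGrammar : ContextFreeGrammar (Fin 11) where
  NT := Option (Bool × Fin 3)
  initial := none
  rules := blockRules

lemma mem_blockRules {r : ContextFreeRule (Fin 11) (Option (Bool × Fin 3))} :
    r ∈ blockRules ↔
      r = ⟨none, [.terminal 0, .nonterminal (some (true, 0)), .terminal 1,
        .nonterminal (some (true, 1)), .terminal 2, .nonterminal (some (true, 2))]⟩ ∨
      (∃ s, ⟨some (true, s), [.terminal 3, .terminal 3, .terminal 3,
        .nonterminal (some (true, s)), .nonterminal (some (false, s))]⟩ = r) ∨
      (∃ s, ⟨some (true, s), [.terminal 3, .terminal 3, .terminal 3]⟩ = r) ∨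
      (∃ s, ⟨some (false, s), [.nonterminal (some (false, s)), .terminal 3]⟩ = r) ∨
      ∃ s, ⟨some (false, s), [.terminal (blockLetter s)]⟩ = r := by
  simp only [blockRules, Finset.mem_union, Finset.mem_singleton, Finset.mem_image,
    Finset.mem_univ, true_and]

lemma derives_of_mem_blockRules {r : ContextFreeRule (Fin 11) (Option (Bool × Fin 3))}
    (hr : r ∈ blockRules) : blockGrammar.Derives [.nonterminal r.input] r.output :=
  ContextFreeGrammar.derives_of_mem_rules (g := blockGrammar) hr

/-- Words over the letters `s` and `3` with `m` occurrences of `s`. -/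
def IsFilled (s : Fin 3) (m : ℕ) (v : List (Fin 11)) : Prop :=
  v.filter (· ≠ 3) = List.replicate m (blockLetter s)

lemma IsFilled.append {s : Fin 3} {m k : ℕ} {v w : List (Fin 11)} (hv : IsFilled s m v)
    (hw : IsFilled s k w) : IsFilled s (m + k) (v ++ w) := by
  simp only [IsFilled, List.filter_append, List.replicate_add] at *
  rw [hv, hw]

lemma isFilled_replicate (s : Fin 3) (k : ℕ) : IsFilled s 0 (List.replicate k 3) := by
  simp [IsFilled]

lemma isFilled_singleton (s : Fin 3) : IsFilled s 1 [blockLetter s] := by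
  fin_cases s <;> rfl

/-- The languages of the nonterminals of `blockGrammar`, except that the one for the initial
nonterminal is spelled out by `blockWords`. -/
def partWords : Bool × Fin 3 → Language (Fin 11)
  | (true, s) => {w | ∃ m v, w = List.replicate (3 * (m + 1)) 3 ++ v ∧ IsFilled s m v}
  | (false, s) => {w | IsFilled s 1 w}

/-- A superset of the language of `blockGrammar`. -/
def blockWords : Language (Fin 11) :=
  {[0]} * (partWords (true, 0) * ({[1]} * (partWords (true, 1) *
    ({[2]} * partWords (true, 2)))))

lemma blockGrammar_language_le : blockGrammar.language ≤ blockWords := by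
  intro w hw
  let J : Symbol (Fin 11) blockGrammar.NT → Language (Fin 11)
    | .terminal t => {[t]}
    | .nonterminal none => blockWords
    | .nonterminal (some A) => partWords A
  suffices hJ : ∀ r ∈ blockRules, (r.output.map J).prod ≤ J (.nonterminal r.input) by
    have h : w ∈ blockWords * 1 :=
      ContextFreeGrammar.mem_of_derives (g := blockGrammar) J (fun t ↦ rfl) hJ hw
    rwa [mul_one] at h
  intro r hr
  rcases mem_blockRules.1 hr with rfl | ⟨s, rfl⟩ | ⟨s, rfl⟩ | ⟨s, rfl⟩ | ⟨s, rfl⟩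
  · change _ * (_ * (_ * (_ * (_ * (_ * 1))))) ≤ _
    rw [mul_one]
    exact le_rfl
  · rintro _ ⟨_, rfl, _, ⟨_, rfl, _, ⟨_, rfl, _, ⟨_, ⟨m, v, rfl, hv⟩, _, ⟨y, hy, _, rfl, rfl⟩,
      rfl⟩, rfl⟩, rfl⟩, rfl⟩
    refine ⟨m + 1, v ++ y, ?_, hv.append hy⟩
    simp [mul_add, List.replicate_succ]
  · rintro _ ⟨_, rfl, _, ⟨_, rfl, _, ⟨_, rfl, _, rfl, rfl⟩, rfl⟩, rfl⟩
    exact ⟨0, [], rfl, rfl⟩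
  · rintro _ ⟨y, hy, _, ⟨_, rfl, _, rfl, rfl⟩, rfl⟩
    exact IsFilled.append hy (isFilled_replicate s 1)
  · rintro _ ⟨_, rfl, _, rfl, rfl⟩
    exact isFilled_singleton s

lemma diag_eq_of_mem_blockWords {w : List (Fin 11)} (hw : w ∈ blockWords) {n : ℕ}
    (hn : w.length = n ^ 2) (h3 : 3 ∉ diag n w) :
    ∃ p, diag n w = List.replicate p 0 ++ List.replicate p 1 ++ List.replicate p 2 := by
  obtain ⟨_, rfl, _, ⟨_, ⟨m₀, v₀, rfl, h₀⟩, _, ⟨_, rfl, _, ⟨_, ⟨m₁, v₁, rfl, h₁⟩,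
    _, ⟨_, rfl, _, ⟨m₂, v₂, rfl, h₂⟩, rfl⟩, rfl⟩, rfl⟩, rfl⟩, rfl⟩ := hw
  simp only at hn h3 ⊢
  set w := [(0 : Fin 11)] ++ ((List.replicate (3 * (m₀ + 1)) 3 ++ v₀) ++ ([1] ++
    ((List.replicate (3 * (m₁ + 1)) 3 ++ v₁) ++ ([2] ++
    (List.replicate (3 * (m₂ + 1)) 3 ++ v₂))))) with hw
  have hl₀ : 3 * (m₀ + 1) ≤ n := le_of_replicate_isInfix hn h3
    ⟨[0], v₀ ++ ([1] ++ ((List.replicate (3 * (m₁ + 1)) 3 ++ v₁) ++ ([2] ++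
      (List.replicate (3 * (m₂ + 1)) 3 ++ v₂)))), by simp [hw]⟩
  have hl₁ : 3 * (m₁ + 1) ≤ n := le_of_replicate_isInfix hn h3
    ⟨[0] ++ ((List.replicate (3 * (m₀ + 1)) 3 ++ v₀) ++ [1]), v₁ ++ ([2] ++
      (List.replicate (3 * (m₂ + 1)) 3 ++ v₂)), by simp [hw]⟩
  have hl₂ : 3 * (m₂ + 1) ≤ n := le_of_replicate_isInfix hn h3
    ⟨[0] ++ ((List.replicate (3 * (m₀ + 1)) 3 ++ v₀) ++ ([1] ++
      ((List.replicate (3 * (m₁ + 1)) 3 ++ v₁) ++ [2]))), v₂, by simp [hw]⟩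
  have hf : w.filter (· ≠ 3) = List.replicate (m₀ + 1) 0 ++ List.replicate (m₁ + 1) 1 ++
      List.replicate (m₂ + 1) 2 := by
    rw [hw]
    simp only [List.filter_append]
    rw [h₀, h₁, h₂]
    simp [List.replicate_succ, blockLetter]
  have hs := (diag_sublist hn).filter (· ≠ 3)
  rw [List.filter_eq_self.2 (fun x hx ↦ by simpa using ne_of_mem_of_not_mem hx h3), hf] at hs
  have hlen := hs.length_le
  rw [length_diag hn] at hlen
  simp only [List.length_append, List.length_replicate] at hlen
  refine ⟨m₀ + 1, ?_⟩
  obtain rfl : m₁ = m₀ := by omega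
  obtain rfl : m₂ = m₁ := by omega
  refine hs.eq_of_length ?_
  rw [length_diag hn]
  simp
  omega

section generation

variable {s : Fin 3}

lemma derives_letter_append_replicate (s : Fin 3) (k : ℕ) :
    blockGrammar.Derives [.nonterminal (some (false, s))]
      ((blockLetter s :: List.replicate k 3).map .terminal) := by
  induction k with
  | zero =>
    exact derives_of_mem_blockRules
      (r := ⟨some (false, s), [.terminal (blockLetter s)]⟩) (mem_blockRules.2 (by simp))
  | succ k ih =>
    refine (derives_of_mem_blockRules
      (r := ⟨some (false, s), [.nonterminal (some (false, s)), .terminal 3]⟩)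
      (mem_blockRules.2 (by simp))).trans ?_
    rw [List.replicate_succ', ← List.cons_append, List.map_append]
    exact ih.append_right [.terminal 3]

lemma derives_nil_fill (s : Fin 3) :
    blockGrammar.Derives [.nonterminal (some (true, s))]
      ((List.replicate 3 3).map .terminal) :=
  derives_of_mem_blockRules
    (r := ⟨some (true, s), [.terminal 3, .terminal 3, .terminal 3]⟩) (mem_blockRules.2 (by simp))

lemma derives_fill_succ {v : List (Fin 11)} {m : ℕ}
    (h : blockGrammar.Derives [.nonterminal (some (true, s))]
      ((List.replicate (3 * (m + 1)) 3 ++ v).map .terminal)) (k : ℕ) :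
    blockGrammar.Derives [.nonterminal (some (true, s))]
      ((List.replicate (3 * (m + 2)) 3 ++
        (v ++ blockLetter s :: List.replicate k 3)).map .terminal) := by
  have hr := derives_of_mem_blockRules
    (r := ⟨some (true, s), [.terminal 3, .terminal 3, .terminal 3,
      .nonterminal (some (true, s)), .nonterminal (some (false, s))]⟩) (mem_blockRules.2 (by simp))
  have h' := (h.append (derives_letter_append_replicate s k)).append_left
    [.terminal 3, .terminal 3, .terminal 3]
  have := hr.trans h'
  rw [show 3 * (m + 2) = 3 + 3 * (m + 1) by ring, List.replicate_add]
  simpa [List.replicate_succ] using this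

lemma derives_fill (s : Fin 3) (n m : ℕ) :
    blockGrammar.Derives [.nonterminal (some (true, s))]
      ((List.replicate (3 * (m + 1)) 3 ++ (List.replicate m (blockLetter s)).flatMap
        fun x ↦ x :: List.replicate n 3).map .terminal) := by
  induction m with
  | zero => simpa using derives_nil_fill s
  | succ m ih =>
    have := derives_fill_succ ih n
    rwa [List.replicate_succ' (n := m), List.flatMap_append, List.flatMap_singleton]

lemma mem_language_blockGrammar {u₀ u₁ u₂ : List (Fin 11)}
    (h₀ : blockGrammar.Derives [.nonterminal (some (true, 0))] (u₀.map .terminal))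
    (h₁ : blockGrammar.Derives [.nonterminal (some (true, 1))] (u₁.map .terminal))
    (h₂ : blockGrammar.Derives [.nonterminal (some (true, 2))] (u₂.map .terminal)) :
    0 :: u₀ ++ 1 :: u₁ ++ 2 :: u₂ ∈ blockGrammar.language := by
  have hr := derives_of_mem_blockRules
    (r := ⟨none, [.terminal 0, .nonterminal (some (true, 0)), .terminal 1,
      .nonterminal (some (true, 1)), .terminal 2, .nonterminal (some (true, 2))]⟩)
    (mem_blockRules.2 (by simp))
  have := hr.trans (((h₀.append_left [.terminal 0]).append
    (h₁.append_left [.terminal 1])).append (h₂.append_left [.terminal 2]))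
  rw [ContextFreeGrammar.mem_language_iff]
  simp only [List.map_append, List.map_cons]
  exact this

lemma mem_diagL_blockGrammar (p : ℕ) :
    List.replicate (p + 2) 0 ++ List.replicate (p + 2) 1 ++ List.replicate (p + 2) 2 ∈
      diagL blockGrammar.language := by
  set d : List (Fin 11) := List.replicate (p + 2) 0 ++ List.replicate (p + 2) 1 ++
    List.replicate (p + 1) 2 with hd
  have hlen : d.length + 1 = 3 * (p + 2) := by
    simp [hd]
    ring
  obtain ⟨hl, hdiag⟩ := diag_flatMap_cons_replicate (3 : Fin 11) 2 hlen
  refine ⟨_, ?_, _, by omega, hl, ?_⟩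
  · have h₂ := derives_fill_succ (derives_fill 2 (3 * (p + 2)) p) 0
    have := mem_language_blockGrammar (derives_fill 0 (3 * (p + 2)) (p + 1))
      (derives_fill 1 (3 * (p + 2)) (p + 1)) h₂
    rw [hd]
    simpa [List.replicate_succ (n := p + 1), List.replicate_succ (n := p) (a := (2 : Fin 11)),
      blockLetter] using this
  · rw [hdiag, hd, List.append_assoc _ _ [2], ← List.replicate_succ']

end generation

lemma eq_of_pairwise_append_self {α : Type*} [PartialOrder α] {v : List α}
    (h : (v ++ v).Pairwise (· ≤ ·)) {x y : α} (hx : x ∈ v) (hy : y ∈ v) : x = y :=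
  le_antisymm ((List.pairwise_append.1 h).2.2 x hx y hy)
    ((List.pairwise_append.1 h).2.2 y hy x hx)

lemma not_isContextFree_of_equal_blocks {L : Language (Fin 11)}
    (hmem : ∀ p, List.replicate (p + 2) 0 ++ List.replicate (p + 2) 1 ++
      List.replicate (p + 2) 2 ∈ L)
    (heq : ∀ w ∈ L, 3 ∉ w →
      ∃ p, w = List.replicate p 0 ++ List.replicate p 1 ++ List.replicate p 2) :
    ¬ L.IsContextFree := by
  intro hL
  obtain ⟨B, hB⟩ := hL.exists_pump
  obtain ⟨u, v, x, y, z, hw, hne, hp⟩ := hB _ (hmem B) (by simp; omega)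
  obtain ⟨q, hq⟩ := heq _ hp (fun h ↦ by
    have : 3 ∈ u ++ v ++ x ++ y ++ z := by
      simp only [List.mem_append] at h ⊢
      tauto
    rw [← hw] at this
    simp [List.mem_replicate] at this)
  have hsort : (u ++ v ++ v ++ x ++ y ++ y ++ z).Pairwise (· ≤ ·) := by
    rw [hq]
    simp [List.pairwise_append, List.pairwise_replicate]
  have hv : ∀ a ∈ v, ∀ b ∈ v, a = b := fun a ha b hb ↦ eq_of_pairwise_append_self
    (hsort.sublist (List.IsInfix.sublist ⟨u, x ++ y ++ y ++ z, by simp⟩)) ha hb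
  have hy : ∀ a ∈ y, ∀ b ∈ y, a = b := fun a ha b hb ↦ eq_of_pairwise_append_self
    (hsort.sublist (List.IsInfix.sublist ⟨u ++ v ++ v ++ x, z, by simp⟩)) ha hb
  have hlen := congrArg List.length hw
  have hlen' := congrArg List.length hq
  have hpos := List.length_pos_iff.2 hne
  have hcount (a : Fin 11) := congrArg (List.count a) hw
  have hcount' (a : Fin 11) := congrArg (List.count a) hq
  simp only [List.length_append, List.length_replicate] at hlen hlen' hpos
  simp only [List.count_append] at hcount hcount'
  have hall (a : Fin 11) (ha : a = 0 ∨ a = 1 ∨ a = 2) : a ∈ v ∨ a ∈ y := by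
    by_contra! h
    have h1 := hcount a
    have h2 := hcount' a
    rw [List.count_eq_zero_of_not_mem h.1, List.count_eq_zero_of_not_mem h.2] at h1 h2
    rcases ha with rfl | rfl | rfl <;> simp [List.count_replicate] at h1 h2 <;> omega
  have h0 := hall 0 (by simp)
  have h1 := hall 1 (by simp)
  have h2 := hall 2 (by simp)
  have h01 : (0 : Fin 11) ≠ 1 := by decide
  have h02 : (0 : Fin 11) ≠ 2 := by decide
  have h12 : (1 : Fin 11) ≠ 2 := by decide
  grind

theorem exists_cfl_diag_not_cfl :
    ∃ L : Language (Fin 11), L.IsContextFree ∧ ¬ (diagL L).IsContextFree := by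
  refine ⟨blockGrammar.language, ⟨_, rfl⟩,
    not_isContextFree_of_equal_blocks mem_diagL_blockGrammar ?_⟩
  rintro _ ⟨w, hw, n, -, hn, rfl⟩ h3
  exact diag_eq_of_mem_blockWords (blockGrammar_language_le hw) hn h3
end
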